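/- Let u and u′ be real-valued BMO functions on ℝ such that e^u and e^{u′} are A_∞-weights, and let γ_u(x) = ∫_0^x e^{u(t)} dt. Then the function Q_u(u′) := u′∘γ_u + u is a real-valued BMO function, e^{Q_u(u′)} equals the derivative (γ_{u′}∘γ_u)′ almost everywhere (where γ_{u′}(x) = ∫_0^x e^{u′(t)} dt), and e^{Q_u(u′)} is an A_∞-weight. Hence the affine map Q_u: w ↦ w∘γ_u + u keeps the set of real-valued BMO functions whose exponential is an A_∞-weight invariant. -/

import Mathlib

open MeasureTheory Set Filter Topology
open scoped ENNReal NNReal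

noncomputable section

/-- The average of `u` over the interval from `a` to `b`. -/
noncomputable def intervalAvg {E : Type*} [NormedAddCommGroup E] [NormedSpace ℝ E]
    (u : ℝ → E) (a b : ℝ) : E :=
  (b - a)⁻¹ • ∫ x in a..b, u x

/-- The BMO seminorm `‖u‖_* = sup_I (1/|I|) ∫_I ‖u - u_I‖`, valued in `ℝ≥0∞`. -/
noncomputable def bmoSeminorm {E : Type*} [NormedAddCommGroup E] [NormedSpace ℝ E]
    (u : ℝ → E) : ℝ≥0∞ :=
  ⨆ (a : ℝ) (b : ℝ) (_ : a < b),
    ENNReal.ofReal ((b - a)⁻¹ * ∫ x in a..b, ‖u x - intervalAvg u a b‖)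

/-- `u` is a BMO function: locally integrable with finite BMO seminorm. -/
def IsBMO {E : Type*} [NormedAddCommGroup E] [NormedSpace ℝ E] (u : ℝ → E) : Prop :=
  LocallyIntegrable u volume ∧ bmoSeminorm u < ⊤

/-- `ω` is an `A_p`-weight of Muckenhoupt on `ℝ` (`p > 1`). -/
def IsApWeight (ω : ℝ → ℝ) (p : ℝ) : Prop :=
  (∀ x, 0 ≤ ω x) ∧ LocallyIntegrable ω volume ∧
    LocallyIntegrable (fun x => (1 / ω x) ^ (1 / (p - 1))) volume ∧
    ∃ C : ℝ, 1 ≤ C ∧ ∀ a b : ℝ, a < b →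
      ((b - a)⁻¹ * ∫ x in a..b, ω x) *
        ((b - a)⁻¹ * ∫ x in a..b, (1 / ω x) ^ (1 / (p - 1))) ^ (p - 1) ≤ C

/-- `ω` is an `A_∞`-weight: an `A_p`-weight for some `p > 1`. -/
def IsAInftyWeight (ω : ℝ → ℝ) : Prop :=
  ∃ p : ℝ, 1 < p ∧ IsApWeight ω p

/-- `ω` is an `A_1`-weight of Muckenhoupt on `ℝ`. -/
def IsA1Weight (ω : ℝ → ℝ) : Prop :=
  (∀ x, 0 ≤ ω x) ∧ LocallyIntegrable ω volume ∧
    ∃ C : ℝ, 1 ≤ C ∧ ∀ a b : ℝ, a < b →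
      (b - a)⁻¹ * ∫ x in a..b, ω x ≤ C * essInf ω (volume.restrict (Set.Ioo a b))

/-- `f` is locally absolutely continuous with derivative `f'`. -/
def IsLocAC {E : Type*} [NormedAddCommGroup E] [NormedSpace ℝ E] (f f' : ℝ → E) : Prop :=
  LocallyIntegrable f' volume ∧ ∀ a b : ℝ, a < b → f b - f a = ∫ t in a..b, f' t

/-- `f` is a strongly quasisymmetric homeomorphism of `ℝ` with derivative `f'`:
an increasing homeomorphism of `ℝ` onto itself, locally absolutely continuous,
whose derivative is an `A_∞`-weight. -/
def IsSQSWith (f f' : ℝ → ℝ) : Prop :=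
  StrictMono f ∧ Function.Surjective f ∧ IsLocAC f f' ∧ IsAInftyWeight f'

/-- `f` is a strongly quasisymmetric homeomorphism of `ℝ` onto itself. -/
def IsSQS (f : ℝ → ℝ) : Prop :=
  ∃ f', IsSQSWith f f'

/-- `γ_u(x) = ∫_0^x e^{u(t)} dt`. -/
noncomputable def gammaOf (u : ℝ → ℝ) (x : ℝ) : ℝ :=
  ∫ t in (0:ℝ)..x, Real.exp (u t)

end

theorem locallyIntegrable_iff_forall_integrableOn_Ioc {f : ℝ → ℝ} :
    LocallyIntegrable f volume ↔ ∀ a b : ℝ, IntegrableOn f (Ioc a b) volume := by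
  refine ⟨fun h a b => (h.integrableOn_isCompact isCompact_Icc).mono_set Ioc_subset_Icc_self,
    fun h x => ⟨Ioc (x - 1) (x + 1), Ioc_mem_nhds (by linarith) (by linarith), h _ _⟩⟩

theorem intervalIntegrable_of_locallyIntegrable {f : ℝ → ℝ} (hf : LocallyIntegrable f volume)
    (a b : ℝ) : IntervalIntegrable f volume a b :=
  ⟨locallyIntegrable_iff_forall_integrableOn_Ioc.1 hf a b,
    locallyIntegrable_iff_forall_integrableOn_Ioc.1 hf b a⟩

section ChangeOfVariables

variable {u : ℝ → ℝ}

theorem gammaOf_sub (hw : LocallyIntegrable (fun x => Real.exp (u x)) volume) (a b : ℝ) :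
    gammaOf u b - gammaOf u a = ∫ x in a..b, Real.exp (u x) :=
  intervalIntegral.integral_interval_sub_left (intervalIntegrable_of_locallyIntegrable hw _ _)
    (intervalIntegrable_of_locallyIntegrable hw _ _)

theorem gammaOf_strictMono (hw : LocallyIntegrable (fun x => Real.exp (u x)) volume) :
    StrictMono (gammaOf u) := by
  intro a b hab
  have h := gammaOf_sub hw a b
  have := intervalIntegral.intervalIntegral_pos_of_pos
    (intervalIntegrable_of_locallyIntegrable hw a b) (fun x => Real.exp_pos _) hab
  linarith

theorem gammaOf_continuous (hw : LocallyIntegrable (fun x => Real.exp (u x)) volume) :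
    Continuous (gammaOf u) :=
  intervalIntegral.continuous_primitive (intervalIntegrable_of_locallyIntegrable hw) 0

theorem lintegral_Ioc_exp (hw : LocallyIntegrable (fun x => Real.exp (u x)) volume)
    {a b : ℝ} (hab : a ≤ b) :
    ∫⁻ x in Ioc a b, ENNReal.ofReal (Real.exp (u x)) =
      ENNReal.ofReal (gammaOf u b - gammaOf u a) := by
  rw [gammaOf_sub hw, intervalIntegral.integral_of_le hab,
    ofReal_integral_eq_lintegral_ofReal (locallyIntegrable_iff_forall_integrableOn_Ioc.1 hw a b)
      (Eventually.of_forall fun x => (Real.exp_pos _).le)]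

theorem aemeasurable_ofReal_exp (hw : LocallyIntegrable (fun x => Real.exp (u x)) volume)
    (s : Set ℝ) : AEMeasurable (fun x => ENNReal.ofReal (Real.exp (u x))) (volume.restrict s) :=
  hw.aestronglyMeasurable.aemeasurable.ennreal_ofReal.restrict

theorem map_gammaOf_withDensity (hw : LocallyIntegrable (fun x => Real.exp (u x)) volume)
    {a b : ℝ} (hab : a ≤ b) :
    Measure.map (gammaOf u)
      ((volume.restrict (Ioc a b)).withDensity fun x => ENNReal.ofReal (Real.exp (u x))) =
      volume.restrict (Ioc (gammaOf u a) (gammaOf u b)) := by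
  have hmono := gammaOf_strictMono hw
  have hcont := gammaOf_continuous hw
  symm
  apply Measure.ext_of_Iic
  intro y
  rw [Measure.map_apply hcont.measurable measurableSet_Iic,
    withDensity_apply _ (hcont.measurable measurableSet_Iic),
    Measure.restrict_restrict (hcont.measurable measurableSet_Iic),
    Measure.restrict_apply measurableSet_Iic]
  rcases lt_or_ge y (gammaOf u a) with hy | hy
  · have h1 : Iic y ∩ Ioc (gammaOf u a) (gammaOf u b) = ∅ := by
      ext z
      simp only [mem_inter_iff, mem_Iic, mem_Ioc, mem_empty_iff_false, iff_false]
      rintro ⟨h, h', -⟩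
      linarith
    have h2 : gammaOf u ⁻¹' Iic y ∩ Ioc a b = ∅ := by
      ext z
      simp only [mem_inter_iff, mem_preimage, mem_Iic, mem_Ioc, mem_empty_iff_false, iff_false]
      rintro ⟨h, h', -⟩
      linarith [hmono h']
    rw [h1, h2]
    simp
  · obtain ⟨c, hc, hcy⟩ : ∃ c ∈ Icc a b, gammaOf u c = min y (gammaOf u b) :=
      intermediate_value_Icc hab hcont.continuousOn
        ⟨le_min hy (hmono.monotone hab), min_le_right _ _⟩
    have h1 : Iic y ∩ Ioc (gammaOf u a) (gammaOf u b) = Ioc (gammaOf u a) (gammaOf u c) := by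
      rw [hcy]
      ext z
      simp only [mem_inter_iff, mem_Iic, mem_Ioc, le_min_iff]
      tauto
    have h2 : gammaOf u ⁻¹' Iic y ∩ Ioc a b = Ioc a c := by
      ext z
      have h3 : gammaOf u z ≤ gammaOf u c ↔ z ≤ c := hmono.le_iff_le
      have h4 : gammaOf u z ≤ gammaOf u b ↔ z ≤ b := hmono.le_iff_le
      rw [hcy, le_min_iff, h4] at h3
      simp only [mem_inter_iff, mem_preimage, mem_Iic, mem_Ioc]
      tauto
    rw [h1, h2, Real.volume_Ioc, lintegral_Ioc_exp hw hc.1]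

theorem integrableOn_comp_gammaOf_mul_exp
    (hw : LocallyIntegrable (fun x => Real.exp (u x)) volume) {f : ℝ → ℝ}
    (hf : LocallyIntegrable f volume) {a b : ℝ} (hab : a ≤ b) :
    IntegrableOn (fun x => f (gammaOf u x) * Real.exp (u x)) (Ioc a b) volume := by
  have h := locallyIntegrable_iff_forall_integrableOn_Ioc.1 hf (gammaOf u a) (gammaOf u b)
  rw [IntegrableOn, ← map_gammaOf_withDensity hw hab,
    integrable_map_measure h.aestronglyMeasurable
      (gammaOf_continuous hw).measurable.aemeasurable,
    integrable_withDensity_iff_integrable_smul₀' (aemeasurable_ofReal_exp hw _)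
      (Eventually.of_forall fun x => ENNReal.ofReal_lt_top)] at h
  refine h.congr (Eventually.of_forall fun x => ?_)
  simp [ENNReal.toReal_ofReal (Real.exp_pos _).le, mul_comm]

theorem integral_comp_gammaOf_mul_exp
    (hw : LocallyIntegrable (fun x => Real.exp (u x)) volume) {f : ℝ → ℝ}
    (hf : AEStronglyMeasurable f volume) {a b : ℝ} (hab : a ≤ b) :
    ∫ x in a..b, f (gammaOf u x) * Real.exp (u x) = ∫ y in gammaOf u a..gammaOf u b, f y := by
  rw [intervalIntegral.integral_of_le hab,
    intervalIntegral.integral_of_le ((gammaOf_strictMono hw).monotone hab),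
    ← map_gammaOf_withDensity hw hab,
    integral_map (gammaOf_continuous hw).measurable.aemeasurable
      (by rw [map_gammaOf_withDensity hw hab]; exact hf.restrict),
    integral_withDensity_eq_integral_toReal_smul₀ (aemeasurable_ofReal_exp hw _)
      (Eventually.of_forall fun x => ENNReal.ofReal_lt_top)]
  refine integral_congr_ae (Eventually.of_forall fun x => ?_)
  simp [ENNReal.toReal_ofReal (Real.exp_pos _).le, mul_comm]

end ChangeOfVariables

theorem one_div_exp_rpow (t s : ℝ) : (1 / Real.exp t) ^ s = Real.exp (-(s * t)) := by
  rw [one_div, ← Real.exp_neg, ← Real.exp_mul]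
  ring_nf

/-- Jensen's inequality for the exponential on an interval. -/
theorem exp_intervalAvg_le {φ : ℝ → ℝ} {a b : ℝ} (hab : a < b)
    (hφ : IntervalIntegrable φ volume a b)
    (he : IntervalIntegrable (fun x => Real.exp (φ x)) volume a b) :
    Real.exp (intervalAvg φ a b) ≤ intervalAvg (fun x => Real.exp (φ x)) a b := by
  have hL : 0 < b - a := sub_pos.2 hab
  set m := intervalAvg φ a b with hm
  have hint : ∫ x in a..b, φ x = (b - a) * m := by
    rw [hm, intervalAvg, smul_eq_mul]
    field_simp
  have hle : ∫ x in a..b, Real.exp m * (φ x - m + 1) ≤ ∫ x in a..b, Real.exp (φ x) := by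
    refine intervalIntegral.integral_mono hab.le ?_ he fun x => ?_
    · exact ((hφ.sub intervalIntegrable_const).add intervalIntegrable_const).const_mul _
    · calc Real.exp m * (φ x - m + 1) ≤ Real.exp m * Real.exp (φ x - m) :=
            mul_le_mul_of_nonneg_left (Real.add_one_le_exp _) (Real.exp_pos _).le
        _ = Real.exp (φ x) := by rw [← Real.exp_add]; ring_nf
  rw [intervalIntegral.integral_const_mul,
    intervalIntegral.integral_add (hφ.sub intervalIntegrable_const) intervalIntegrable_const,
    intervalIntegral.integral_sub hφ intervalIntegrable_const, hint] at hle
  simp only [intervalIntegral.integral_const, smul_eq_mul] at hle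
  rw [intervalAvg, smul_eq_mul, inv_mul_eq_div, le_div_iff₀ hL]
  linarith

theorem abs_le_exp_add_exp {s : ℝ} (hs : 0 < s) (t : ℝ) :
    |t| ≤ Real.exp t + s⁻¹ * Real.exp (-(s * t)) := by
  have h1 := Real.add_one_le_exp t
  have h2 : s⁻¹ * (-(s * t) + 1) ≤ s⁻¹ * Real.exp (-(s * t)) :=
    mul_le_mul_of_nonneg_left (Real.add_one_le_exp _) (inv_pos.2 hs).le
  have h3 : s⁻¹ * (-(s * t) + 1) = -t + s⁻¹ := by field_simp
  have h4 : 0 < s⁻¹ * Real.exp (-(s * t)) := by positivity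
  have h5 := Real.exp_pos t
  have h6 := inv_pos.2 hs
  rw [abs_le]
  constructor <;> linarith

/-- The logarithm of an `A_∞`-weight is a BMO function. -/
theorem IsAInftyWeight.isBMO_of_exp {φ : ℝ → ℝ} (h : IsAInftyWeight fun x => Real.exp (φ x)) :
    IsBMO φ := by
  obtain ⟨p, hp, -, hw, hσ, C, hC, hA⟩ := h
  simp only [one_div_exp_rpow] at hσ hA
  set s := 1 / (p - 1) with hs_def
  have hp1 : 0 < p - 1 := sub_pos.2 hp
  have hs : 0 < s := by positivity
  have hps : p - 1 = s⁻¹ := by rw [hs_def, one_div, inv_inv]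
  rw [hps] at hA
  have hmeas : AEStronglyMeasurable φ volume := by
    have := (Real.measurable_log.comp_aemeasurable hw.aestronglyMeasurable.aemeasurable)
    simpa [Function.comp_def] using this.aestronglyMeasurable
  have hφ : LocallyIntegrable φ volume := by
    refine (hw.add (hσ.smul s⁻¹)).mono hmeas (Eventually.of_forall fun x => ?_)
    refine (abs_le_exp_add_exp hs (φ x)).trans ?_
    exact le_abs_self _
  refine ⟨hφ, ?_⟩
  refine lt_of_le_of_lt (b := ENNReal.ofReal (C + s⁻¹ * C ^ s)) ?_ ENNReal.ofReal_lt_top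
  refine iSup_le fun a => iSup_le fun b => iSup_le fun hab => ENNReal.ofReal_le_ofReal ?_
  have hL : 0 < b - a := sub_pos.2 hab
  have iφ := intervalIntegrable_of_locallyIntegrable hφ a b
  have iw := intervalIntegrable_of_locallyIntegrable hw a b
  have iσ := intervalIntegrable_of_locallyIntegrable hσ a b
  specialize hA a b hab
  have j1 := exp_intervalAvg_le hab iφ iw
  have j2 := exp_intervalAvg_le (φ := fun x => -(s * φ x)) hab (iφ.const_mul s).neg iσ
  have havg : intervalAvg (fun x => -(s * φ x)) a b = -(s * intervalAvg φ a b) := by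
    simp only [intervalAvg, intervalIntegral.integral_neg, intervalIntegral.integral_const_mul,
      smul_eq_mul]
    ring
  rw [havg] at j2
  set m := intervalAvg φ a b with hm
  simp only [intervalAvg, smul_eq_mul] at j1 j2
  set X := (b - a)⁻¹ * ∫ x in a..b, Real.exp (φ x) with hX
  set Y := (b - a)⁻¹ * ∫ x in a..b, Real.exp (-(s * φ x)) with hY
  have hYpos : 0 < Y := (Real.exp_pos _).trans_le j2
  have hXpos : 0 < X := (Real.exp_pos _).trans_le j1
  have hX' : Real.exp (-m) * X ≤ C := by
    refine le_trans ?_ hA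
    rw [mul_comm]
    refine mul_le_mul_of_nonneg_left ?_ hXpos.le
    calc Real.exp (-m) = Real.exp (-(s * m)) ^ s⁻¹ := by
          rw [← Real.exp_mul]; congr 1; field_simp
      _ ≤ Y ^ s⁻¹ := Real.rpow_le_rpow (Real.exp_pos _).le j2 (inv_pos.2 hs).le
  have hY' : Real.exp (s * m) * Y ≤ C ^ s := by
    have h1 : Real.exp m * Y ^ s⁻¹ ≤ C :=
      (mul_le_mul_of_nonneg_right j1 (by positivity)).trans hA
    have h2 := Real.rpow_le_rpow (by positivity) h1 hs.le
    rw [Real.mul_rpow (Real.exp_pos _).le (by positivity), ← Real.rpow_mul hYpos.le,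
      inv_mul_cancel₀ hs.ne', Real.rpow_one, ← Real.exp_mul] at h2
    rwa [mul_comm s m]
  have hle : ∫ x in a..b, ‖φ x - m‖ ≤ ∫ x in a..b,
      (Real.exp (-m) * Real.exp (φ x) + s⁻¹ * Real.exp (s * m) * Real.exp (-(s * φ x))) := by
    refine intervalIntegral.integral_mono hab.le (iφ.sub intervalIntegrable_const).norm
      ((iw.const_mul _).add (iσ.const_mul _)) fun x => ?_
    refine (abs_le_exp_add_exp hs (φ x - m)).trans (le_of_eq ?_)
    rw [mul_assoc, ← Real.exp_add, ← Real.exp_add]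
    ring_nf
  rw [intervalIntegral.integral_add (iw.const_mul _) (iσ.const_mul _),
    intervalIntegral.integral_const_mul, intervalIntegral.integral_const_mul] at hle
  calc (b - a)⁻¹ * ∫ x in a..b, ‖φ x - m‖
      ≤ (b - a)⁻¹ * _ := mul_le_mul_of_nonneg_left hle (inv_pos.2 hL).le
    _ = Real.exp (-m) * X + s⁻¹ * (Real.exp (s * m) * Y) := by rw [hX, hY]; ring
    _ ≤ C + s⁻¹ * C ^ s := by gcongr

/-- Hölder's inequality for exponentials, together with integrability of the product. -/
theorem integral_exp_add_le {k l : ℝ} (hkl : k.HolderConjugate l) {μ : Measure ℝ} {F G : ℝ → ℝ}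
    (hF : Integrable (fun x => Real.exp (k * F x)) μ)
    (hG : Integrable (fun x => Real.exp (l * G x)) μ) :
    Integrable (fun x => Real.exp (F x + G x)) μ ∧
      ∫ x, Real.exp (F x + G x) ∂μ ≤
        (∫ x, Real.exp (k * F x) ∂μ) ^ (1 / k) * (∫ x, Real.exp (l * G x) ∂μ) ^ (1 / l) := by
  have key : ∀ {m : ℝ} {H : ℝ → ℝ}, 0 < m → Integrable (fun x => Real.exp (m * H x)) μ →
      MemLp (fun x => Real.exp (H x)) (ENNReal.ofReal m) μ := by
    intro m H hm hH
    have hmeas : AEStronglyMeasurable (fun x => Real.exp (H x)) μ := by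
      have h : (fun x => Real.exp (H x)) = fun x => Real.exp (m * H x) ^ m⁻¹ := by
        funext x
        rw [← Real.exp_mul]
        congr 1
        field_simp
      rw [h]
      exact (hH.aestronglyMeasurable.aemeasurable.pow_const _).aestronglyMeasurable
    rw [← integrable_norm_rpow_iff hmeas (by simpa using hm) ENNReal.ofReal_ne_top]
    refine hH.congr (Eventually.of_forall fun x => ?_)
    simp only [Real.norm_eq_abs, Real.abs_exp, ENNReal.toReal_ofReal hm.le, ← Real.exp_mul]
    ring_nf
  have hk : 0 < k := hkl.pos
  have hl : 0 < l := hkl.symm.pos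
  have mF := key hk hF
  have mG := key hl hG
  have : (ENNReal.ofReal k).HolderTriple (ENNReal.ofReal l) 1 := by
    simpa using hkl.ennrealOfReal
  refine ⟨(mF.integrable_mul mG).congr (Eventually.of_forall fun x => ?_), ?_⟩
  · simp [Real.exp_add]
  · have h := integral_mul_le_Lp_mul_Lq_of_nonneg hkl
      (Eventually.of_forall fun x => (Real.exp_pos (F x)).le)
      (Eventually.of_forall fun x => (Real.exp_pos (G x)).le) mF mG
    simpa only [← Real.exp_add, ← Real.exp_mul, mul_comm] using h

/-- If `e^u ∈ A_p` and `e^v ∈ A_q`, then `(e^v ∘ γ_u) e^u ∈ A_{pq}`. -/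
theorem IsApWeight.exp_comp_gammaOf_add {u v : ℝ → ℝ} {p q : ℝ} (hp : 1 < p) (hq : 1 < q)
    (hu : IsApWeight (fun x => Real.exp (u x)) p) (hv : IsApWeight (fun x => Real.exp (v x)) q) :
    IsApWeight (fun x => Real.exp (v (gammaOf u x) + u x)) (p * q) := by
  obtain ⟨-, hw, hσ, C, hC, hA⟩ := hu
  obtain ⟨-, hw', hσ', C', hC', hA'⟩ := hv
  simp only [one_div_exp_rpow] at hσ hA hσ' hA'
  have hp1 : 0 < p - 1 := sub_pos.2 hp
  have hq1 : 0 < q - 1 := sub_pos.2 hq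
  have hq0 : 0 < q := by linarith
  have hpq1 : 0 < p * q - 1 := by nlinarith
  have hmono := gammaOf_strictMono hw
  set k := (p * q - 1) / (q - 1) with hk
  set l := (p * q - 1) / (q * (p - 1)) with hl
  have hkl : k.HolderConjugate l := by
    rw [Real.holderConjugate_iff]
    constructor
    · rw [hk, lt_div_iff₀ hq1]
      nlinarith
    · rw [hk, hl]
      field_simp
      ring
  have eF : ∀ x, k * (-(1 / (p * q - 1) * v (gammaOf u x)) + u x / k) =
      -(1 / (q - 1) * v (gammaOf u x)) + u x := by
    intro x
    rw [hk]
    field_simp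
  have eG : ∀ x, l * (-(1 / (p * q - 1) + 1 / k) * u x) = -(1 / (p - 1) * u x) := by
    intro x
    rw [hk, hl]
    field_simp
    ring
  have eFG : ∀ x, -(1 / (p * q - 1) * v (gammaOf u x)) + u x / k +
      -(1 / (p * q - 1) + 1 / k) * u x =
        -(1 / (p * q - 1) * (v (gammaOf u x) + u x)) := by
    intro x
    ring
  have holder : ∀ a b : ℝ, a ≤ b →
      IntegrableOn (fun x => Real.exp (-(1 / (p * q - 1) * (v (gammaOf u x) + u x))))
        (Ioc a b) volume ∧
      ∫ x in a..b, Real.exp (-(1 / (p * q - 1) * (v (gammaOf u x) + u x))) ≤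
        (∫ y in gammaOf u a..gammaOf u b, Real.exp (-(1 / (q - 1) * v y))) ^ (1 / k) *
          (∫ x in a..b, Real.exp (-(1 / (p - 1) * u x))) ^ (1 / l) := by
    intro a b hab
    have h1 := integrableOn_comp_gammaOf_mul_exp hw hσ' hab
    have h2 := integral_comp_gammaOf_mul_exp hw hσ'.aestronglyMeasurable hab
    simp only [← Real.exp_add] at h1 h2
    rw [← h2]
    rw [intervalIntegral.integral_of_le hab, intervalIntegral.integral_of_le hab,
      intervalIntegral.integral_of_le hab]
    have h3 := integral_exp_add_le hkl (μ := volume.restrict (Ioc a b))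
      (F := fun x => -(1 / (p * q - 1) * v (gammaOf u x)) + u x / k)
      (G := fun x => -(1 / (p * q - 1) + 1 / k) * u x)
      (by simp only [eF]; exact h1)
      (by simp only [eG]; exact locallyIntegrable_iff_forall_integrableOn_Ioc.1 hσ a b)
    simpa only [eF, eG, eFG, IntegrableOn] using h3
  have hwv : ∀ a b : ℝ, a ≤ b →
      IntegrableOn (fun x => Real.exp (v (gammaOf u x) + u x)) (Ioc a b) volume := by
    intro a b hab
    simpa only [← Real.exp_add] using integrableOn_comp_gammaOf_mul_exp hw hw' hab
  have of_le : ∀ {f : ℝ → ℝ}, (∀ a b : ℝ, a ≤ b → IntegrableOn f (Ioc a b) volume) →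
      LocallyIntegrable f volume := by
    intro f hf
    refine locallyIntegrable_iff_forall_integrableOn_Ioc.2 fun a b => ?_
    rcases le_total a b with hab | hab
    · exact hf a b hab
    · simp [Ioc_eq_empty_of_le hab]
  refine ⟨fun x => (Real.exp_pos _).le, of_le hwv, ?_, C' * C ^ q,
    one_le_mul_of_one_le_of_one_le hC' (Real.one_le_rpow hC hq0.le), fun a b hab => ?_⟩
  · simp only [one_div_exp_rpow]
    exact of_le fun a b hab => (holder a b hab).1
  simp only [one_div_exp_rpow]
  have hL : 0 < b - a := sub_pos.2 hab
  have hJ : 0 < gammaOf u b - gammaOf u a := sub_pos.2 (hmono hab)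
  have hV := (holder a b hab.le).2
  have hX := integral_comp_gammaOf_mul_exp hw hw'.aestronglyMeasurable hab.le
  simp only [← Real.exp_add] at hX
  specialize hA a b hab
  specialize hA' _ _ (hmono hab)
  rw [hX]
  rw [← gammaOf_sub hw] at hA
  set L := b - a
  set J := gammaOf u b - gammaOf u a
  have hX0 : 0 ≤ ∫ y in gammaOf u a..gammaOf u b, Real.exp (v y) :=
    intervalIntegral.integral_nonneg (hmono hab).le fun x _ => (Real.exp_pos _).le
  have hV0 : 0 ≤ ∫ x in a..b, Real.exp (-(1 / (p * q - 1) * (v (gammaOf u x) + u x))) :=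
    intervalIntegral.integral_nonneg hab.le fun x _ => (Real.exp_pos _).le
  have hB0 : 0 ≤ ∫ x in a..b, Real.exp (-(1 / (p - 1) * u x)) :=
    intervalIntegral.integral_nonneg hab.le fun x _ => (Real.exp_pos _).le
  have hB'0 : 0 ≤ ∫ y in gammaOf u a..gammaOf u b, Real.exp (-(1 / (q - 1) * v y)) :=
    intervalIntegral.integral_nonneg (hmono hab).le fun x _ => (Real.exp_pos _).le
  set X := ∫ y in gammaOf u a..gammaOf u b, Real.exp (v y)
  set V := ∫ x in a..b, Real.exp (-(1 / (p * q - 1) * (v (gammaOf u x) + u x)))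
  set B := ∫ x in a..b, Real.exp (-(1 / (p - 1) * u x))
  set B' := ∫ y in gammaOf u a..gammaOf u b, Real.exp (-(1 / (q - 1) * v y))
  have hVpow : V ^ (p * q - 1) ≤ B' ^ (q - 1) * B ^ (q * (p - 1)) := by
    refine (Real.rpow_le_rpow hV0 hV hpq1.le).trans (le_of_eq ?_)
    rw [Real.mul_rpow (by positivity) (by positivity), ← Real.rpow_mul hB'0, ← Real.rpow_mul hB0]
    congr 2
    · rw [hk]
      field_simp
    · rw [hl]
      field_simp
  have hLpow : L * L ^ (p * q - 1) = L ^ q * L ^ (q * (p - 1)) := by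
    rw [← Real.rpow_one_add' hL.le (by linarith), ← Real.rpow_add hL]
    ring_nf
  have hJpow : J * J ^ (q - 1) = J ^ q := by
    rw [← Real.rpow_one_add' hJ.le (by linarith)]
    ring_nf
  calc L⁻¹ * X * (L⁻¹ * V) ^ (p * q - 1)
      = X * V ^ (p * q - 1) / (L * L ^ (p * q - 1)) := by
        rw [Real.mul_rpow (inv_pos.2 hL).le hV0, Real.inv_rpow hL.le]
        field_simp
    _ ≤ X * (B' ^ (q - 1) * B ^ (q * (p - 1))) / (L * L ^ (p * q - 1)) := by gcongr
    _ = (J⁻¹ * X * (J⁻¹ * B') ^ (q - 1)) * (L⁻¹ * J * (L⁻¹ * B) ^ (p - 1)) ^ q := by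
        rw [Real.mul_rpow (inv_pos.2 hJ).le hB'0, Real.mul_rpow (inv_pos.2 hL).le hB0,
          Real.mul_rpow (by positivity) (by positivity),
          Real.mul_rpow (inv_pos.2 hL).le hJ.le, Real.mul_rpow (by positivity) (by positivity),
          ← Real.rpow_mul (by positivity), ← Real.rpow_mul hB0, Real.inv_rpow hL.le,
          Real.inv_rpow hL.le, Real.inv_rpow hJ.le, hLpow, ← hJpow, mul_comm (p - 1) q]
        field_simp
    _ ≤ C' * C ^ q := by gcongr

/-- for `u, u' ∈ BMO_ℝ^*(ℝ)`, the function `Q_u(u') = u'∘γ_u + u` is a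
real-valued BMO function, `e^{Q_u(u')}` is the derivative of `γ_{u'}∘γ_u` a.e.
(in the integrated, locally-absolutely-continuous sense), and `e^{Q_u(u')}` is an
`A_∞`-weight; hence `Q_u` keeps `BMO_ℝ^*(ℝ)` invariant. -/
theorem statement6 (u u' : ℝ → ℝ) (hu : IsBMO u) (hu' : IsBMO u')
    (hA : IsAInftyWeight fun x => Real.exp (u x))
    (hA' : IsAInftyWeight fun x => Real.exp (u' x)) :
    IsBMO (fun x => u' (gammaOf u x) + u x) ∧
    IsLocAC (fun x => gammaOf u' (gammaOf u x))
      (fun x => Real.exp (u' (gammaOf u x) + u x)) ∧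
    IsAInftyWeight (fun x => Real.exp (u' (gammaOf u x) + u x)) := by
  obtain ⟨p, hp, hup⟩ := hA
  obtain ⟨q, hq, hvq⟩ := hA'
  have hw := hup.2.1
  have hw' := hvq.2.1
  have hpq := hup.exp_comp_gammaOf_add hp hq hvq
  have hinf : IsAInftyWeight fun x => Real.exp (u' (gammaOf u x) + u x) :=
    ⟨p * q, by nlinarith, hpq⟩
  refine ⟨hinf.isBMO_of_exp, ⟨hpq.2.1, fun a b hab => ?_⟩, hinf⟩
  simp only [Real.exp_add]
  rw [gammaOf_sub hw',
    integral_comp_gammaOf_mul_exp (f := fun y => Real.exp (u' y)) hw hw'.aestronglyMeasurable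
      hab.le]
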